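/- For all integers k ≥ 2 and all integers p with 0 ≤ p ≤ k, the identity Ē_p^k = Ē_p^{k−1} + x_k·Ē_{p−1}^{k−1} + q_{k−1}·(1 − x_{k−1})·(Ē_{p−1}^{k−2} + Ē_{p−2}^{k−2}) holds in ℤ[q_1, q_2, …, x_1, x_2, …]. -/

import Mathlib

open MvPolynomial Finset

noncomputable section

/-- The polynomial ring `ℤ[q_1, q_2, …, x_1, x_2, …]`; the variable `Sum.inl i` is `q_i`
and `Sum.inr i` is `x_i`. -/
abbrev P : Type := MvPolynomial (ℕ ⊕ ℕ) ℤ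

/-- The variable `q_i`. -/
def qv (i : ℕ) : P := X (Sum.inl i)

/-- The variable `x_i`. -/
def xv (i : ℕ) : P := X (Sum.inr i)

/-- The polynomial `F_p^k`, defined as `0` unless `0 ≤ p ≤ k`. -/
def Fp (p k : ℤ) : P :=
  if 0 ≤ p ∧ p ≤ k then
    ∑ I ∈ (Finset.Icc 1 k.toNat).powersetCard p.toNat,
      (∏ i ∈ I, (1 - xv i)) * ∏ i ∈ I.filter (fun i => i + 1 ∉ I), (1 - qv i)
  else 0

/-- The substitution `q_k ↦ 0`. -/
def setQ (k : ℕ) : P →ₐ[ℤ] P :=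
  aeval (fun v => if v = Sum.inl k then 0 else X v)

/-- The polynomial `Ê_p^k = Σ_{i=0}^p (−1)^i C(k−i, p−i) F_i^k`, defined as `0` unless
`0 ≤ p ≤ k`. -/
def Ehat (p k : ℤ) : P :=
  if 0 ≤ p ∧ p ≤ k then
    ∑ i ∈ Finset.range (p.toNat + 1),
      (-1 : P) ^ i * (Nat.choose (k.toNat - i) (p.toNat - i) : P) * Fp (i : ℤ) k
  else 0

/-- `Ē_p^k`, i.e. `Ê_p^k` with `q_k` set to `0`. -/
def Ebar (p k : ℤ) : P := setQ k.toNat (Ehat p k)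

/-- The summand of `Fp` indexed by `I`. -/
def weight (I : Finset ℕ) : P :=
  (∏ i ∈ I, (1 - xv i)) * ∏ i ∈ I.filter (fun i => i + 1 ∉ I), (1 - qv i)

/-- The generating polynomial of `Ehat · n`. -/
def ehatGen (n : ℕ) : Polynomial P :=
  ∑ I ∈ (Finset.Icc 1 n).powerset,
    Polynomial.C (weight I) * (-Polynomial.X) ^ #I * (1 + Polynomial.X) ^ (n - #I)

/-- The generating polynomial of `Ebar · n`. -/
def ebarGen (n : ℕ) : Polynomial P := (ehatGen n).map (setQ n).toRingHom

lemma setQ_xv (n i : ℕ) : setQ n (xv i) = xv i := by simp [setQ, xv]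

lemma setQ_qv (n i : ℕ) : setQ n (qv i) = if i = n then 0 else qv i := by simp [setQ, qv]

lemma setQ_weight (n : ℕ) (I : Finset ℕ) :
    setQ n (weight I) =
      (∏ i ∈ I, (1 - xv i)) * ∏ i ∈ I, if i + 1 ∉ I ∧ i ≠ n then 1 - qv i else 1 := by
  rw [weight, Finset.prod_filter, map_mul, map_prod, map_prod]
  congr 1
  · simp [setQ_xv]
  · refine Finset.prod_congr rfl fun i _ => ?_
    split_ifs <;> simp_all [setQ_qv]

lemma setQ_weight_of_notMem {n : ℕ} {I : Finset ℕ} (h : n ∉ I) :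
    setQ n (weight I) = weight I := by
  rw [setQ_weight, weight, Finset.prod_filter]
  congr 1
  refine Finset.prod_congr rfl fun i hi => ?_
  have : i ≠ n := ne_of_mem_of_not_mem hi h
  simp [this]

lemma succ_notMem {n : ℕ} {I : Finset ℕ} (h : I ⊆ Finset.Icc 1 n) : n + 1 ∉ I := fun hm => by
  have := Finset.mem_Icc.1 (h hm)
  omega

lemma weight_insert {n : ℕ} {I : Finset ℕ} (h : I ⊆ Finset.Icc 1 n) :
    weight (insert (n + 1) I) = (1 - xv (n + 1)) * (1 - qv (n + 1)) * setQ n (weight I) := by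
  have h1 := succ_notMem h
  have h2 : n + 1 + 1 ∉ I := fun hm => by
    have := Finset.mem_Icc.1 (h hm)
    omega
  rw [setQ_weight, weight, Finset.prod_filter, Finset.prod_insert h1, Finset.prod_insert h1]
  have : (∏ i ∈ I, if i + 1 ∉ insert (n + 1) I then 1 - qv i else 1)
      = ∏ i ∈ I, if i + 1 ∉ I ∧ i ≠ n then 1 - qv i else 1 := by
    refine Finset.prod_congr rfl fun i _ => ?_
    simp [not_or, and_comm]
  rw [this, if_pos (by simp [h2])]
  ring

lemma setQ_succ_setQ_weight {n : ℕ} {I : Finset ℕ} (h : I ⊆ Finset.Icc 1 n) :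
    setQ (n + 1) (setQ n (weight I)) = setQ n (weight I) := by
  have h1 := succ_notMem h
  rw [setQ_weight, map_mul, map_prod, map_prod]
  congr 1
  · simp [setQ_xv]
  · refine Finset.prod_congr rfl fun i hi => ?_
    have : i ≠ n + 1 := ne_of_mem_of_not_mem hi h1
    split_ifs <;> simp [setQ_qv, this]

lemma setQ_weight_insert {n : ℕ} {I : Finset ℕ} (h : I ⊆ Finset.Icc 1 n) :
    setQ (n + 1) (weight (insert (n + 1) I)) = (1 - xv (n + 1)) * setQ n (weight I) := by
  rw [weight_insert h, map_mul, setQ_succ_setQ_weight h]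
  simp [setQ_xv, setQ_qv]

lemma ebarGen_eq_sum (n : ℕ) :
    ebarGen n = ∑ I ∈ (Finset.Icc 1 n).powerset,
      Polynomial.C (setQ n (weight I)) * (-Polynomial.X) ^ #I
        * (1 + Polynomial.X) ^ (n - #I) := by
  simp [ebarGen, ehatGen, Polynomial.map_sum]

lemma sum_powerset_Icc_succ {M : Type*} [AddCommMonoid M] (n : ℕ) (f : Finset ℕ → M) :
    ∑ I ∈ (Finset.Icc 1 (n + 1)).powerset, f I =
      ∑ I ∈ (Finset.Icc 1 n).powerset, f I
        + ∑ I ∈ (Finset.Icc 1 n).powerset, f (insert (n + 1) I) := by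
  rw [← Finset.insert_Icc_right_eq_Icc_add_one (by omega), Finset.sum_powerset_insert (by simp)]

lemma ebarGen_succ (n : ℕ) :
    ebarGen (n + 1) = (1 + Polynomial.X) * ehatGen n
      - Polynomial.C (1 - xv (n + 1)) * Polynomial.X * ebarGen n := by
  rw [ebarGen_eq_sum, ebarGen_eq_sum, ehatGen, sum_powerset_Icc_succ, sub_eq_add_neg,
    Finset.mul_sum, Finset.mul_sum, ← Finset.sum_neg_distrib]
  refine congrArg₂ (fun a b : Polynomial P => a + b) (Finset.sum_congr rfl fun I hI => ?_)
    (Finset.sum_congr rfl fun I hI => ?_)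
  · rw [Finset.mem_powerset] at hI
    have hc : #I ≤ n := by simpa using Finset.card_le_card hI
    rw [setQ_weight_of_notMem (succ_notMem hI), Nat.succ_sub hc, pow_succ]
    ring
  · rw [Finset.mem_powerset] at hI
    rw [setQ_weight_insert hI, Finset.card_insert_of_notMem (succ_notMem hI),
      Nat.add_sub_add_right, Polynomial.C_mul]
    ring

lemma ehatGen_succ (n : ℕ) :
    ehatGen (n + 1) = ebarGen (n + 1)
      + Polynomial.C (qv (n + 1) * (1 - xv (n + 1))) * Polynomial.X * ebarGen n := by
  rw [ebarGen_eq_sum, ebarGen_eq_sum, ehatGen, sum_powerset_Icc_succ, sum_powerset_Icc_succ,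
    Finset.mul_sum, add_assoc]
  refine congrArg₂ (fun a b : Polynomial P => a + b) (Finset.sum_congr rfl fun I hI => ?_)
    ((Finset.sum_congr rfl fun I hI => ?_).trans Finset.sum_add_distrib)
  · rw [Finset.mem_powerset] at hI
    rw [setQ_weight_of_notMem (succ_notMem hI)]
  · rw [Finset.mem_powerset] at hI
    rw [setQ_weight_insert hI, weight_insert hI, Finset.card_insert_of_notMem (succ_notMem hI),
      Nat.add_sub_add_right]
    simp only [Polynomial.C_mul, Polynomial.C_sub, Polynomial.C_1]
    ring

lemma ebarGen_add_two (n : ℕ) :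
    ebarGen (n + 2) = ebarGen (n + 1) + Polynomial.C (xv (n + 2)) * (Polynomial.X * ebarGen (n + 1))
      + Polynomial.C (qv (n + 1) * (1 - xv (n + 1)))
        * (Polynomial.X * ebarGen n + Polynomial.X * (Polynomial.X * ebarGen n)) := by
  rw [ebarGen_succ (n + 1), ehatGen_succ n, Polynomial.C_sub, Polynomial.C_1]
  ring

lemma Fp_natCast {j n : ℕ} (h : j ≤ n) :
    Fp j n = ∑ I ∈ (Finset.Icc 1 n).powersetCard j, weight I := by
  simp [Fp, weight, h]

lemma ehatGen_eq_sum_Fp (n : ℕ) :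
    ehatGen n = ∑ j ∈ Finset.range (n + 1),
      Polynomial.C ((-1) ^ j * Fp j n) * (Polynomial.X ^ j * (1 + Polynomial.X) ^ (n - j)) := by
  rw [ehatGen, Finset.sum_powerset, Nat.card_Icc, Nat.add_sub_cancel]
  refine Finset.sum_congr rfl fun j hj => ?_
  rw [Fp_natCast (Finset.mem_range_succ_iff.1 hj), Finset.mul_sum, map_sum, Finset.sum_mul]
  refine Finset.sum_congr rfl fun I hI => ?_
  rw [(Finset.mem_powersetCard.1 hI).2, neg_pow]
  simp only [Polynomial.C_mul, Polynomial.C_pow, Polynomial.C_neg, Polynomial.C_1]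
  ring

lemma coeff_ehatGen (n p : ℕ) : (ehatGen n).coeff p = Ehat p n := by
  rw [ehatGen_eq_sum_Fp, Polynomial.finsetSum_coeff]
  simp only [Polynomial.coeff_C_mul, Polynomial.coeff_X_pow_mul', Polynomial.coeff_one_add_X_pow]
  by_cases h : p ≤ n
  · rw [Ehat, if_pos (by omega)]
    simp only [Int.toNat_natCast]
    symm
    rw [← Finset.sum_subset (Finset.range_mono (Nat.succ_le_succ h))]
    · refine Finset.sum_congr rfl fun j hj => ?_
      rw [if_pos (Finset.mem_range_succ_iff.1 hj)]
      ring
    · intro j _ hj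
      rw [if_neg (by simpa using hj), mul_zero]
  · rw [Ehat, if_neg (by omega)]
    refine Finset.sum_eq_zero fun j hj => ?_
    rw [Finset.mem_range_succ_iff] at hj
    rw [Nat.choose_eq_zero_of_lt (by omega)]
    simp

lemma coeff_ebarGen (n p : ℕ) : (ebarGen n).coeff p = Ebar p n := by
  simp [ebarGen, Ebar, coeff_ehatGen]

lemma Ebar_of_neg {p : ℤ} (k : ℤ) (h : p < 0) : Ebar p k = 0 := by
  rw [Ebar, Ehat, if_neg (by omega), map_zero]

lemma coeff_X_mul_ebarGen (n p : ℕ) :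
    (Polynomial.X * ebarGen n).coeff p = Ebar (p - 1) n := by
  cases p with
  | zero => simp [Ebar_of_neg]
  | succ p => simp [Polynomial.coeff_X_mul, coeff_ebarGen]

lemma coeff_X_mul_X_mul_ebarGen (n p : ℕ) :
    (Polynomial.X * (Polynomial.X * ebarGen n)).coeff p = Ebar (p - 2) n := by
  cases p with
  | zero => simp [Ebar_of_neg]
  | succ p =>
    rw [Polynomial.coeff_X_mul, coeff_X_mul_ebarGen]
    congr 1
    push_cast
    ring

/-- For all integers `k ≥ 2` and `0 ≤ p ≤ k`,
`Ē_p^k = Ē_p^{k−1} + x_k·Ē_{p−1}^{k−1} + q_{k−1}·(1 − x_{k−1})·(Ē_{p−1}^{k−2} + Ē_{p−2}^{k−2})`. -/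
theorem statement5 (k p : ℤ) (hk : 2 ≤ k) (hp : 0 ≤ p) (hpk : p ≤ k) :
    Ebar p k = Ebar p (k - 1) + xv k.toNat * Ebar (p - 1) (k - 1)
      + qv (k - 1).toNat * (1 - xv (k - 1).toNat)
        * (Ebar (p - 1) (k - 2) + Ebar (p - 2) (k - 2)) := by
  lift p to ℕ using hp
  obtain ⟨n, rfl⟩ : ∃ n : ℕ, k = n + 2 := ⟨(k - 2).toNat, by omega⟩
  have h := congrArg (Polynomial.coeff · p) (ebarGen_add_two n)
  simp only [Polynomial.coeff_add, Polynomial.coeff_C_mul, coeff_ebarGen, coeff_X_mul_ebarGen,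
    coeff_X_mul_X_mul_ebarGen] at h
  have h1 : (n + 2 : ℤ) - 1 = (n + 1 : ℕ) := by push_cast; ring
  have h2 : (n + 2 : ℤ) = (n + 2 : ℕ) := by push_cast; ring
  rw [h1, add_sub_cancel_right, h2, Int.toNat_natCast, Int.toNat_natCast]
  exact h
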